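/- arXiv:1510.06303 — 2 statements merged into one kernel-verified Lean document; each statement's English description precedes it below -/
import Mathlib

section
/- Let λ ∈ ℝ, and let f, g : ℝ → ℝ be smooth. Define φ : (0,∞) × ℝ → ℝ by φ(u,s) = f(u^λ − u^{λ−1}s²) + 2u^{λ−1}·s·∫₀ˢ f'(u^λ − u^{λ−1}z²) dz + g(u)·s, where u^λ denotes the real power of u > 0. Then φ is smooth and satisfies (λu − (λ−1)s²)·φ₂₂(u,s) = 2u·(φ₁(u,s) − s·φ₁₂(u,s)) for all (u,s) ∈ (0,∞) × ℝ. -/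
open Real Set MeasureTheory intervalIntegral

/-- First partial derivative of `φ = φ(u,s)` with respect to `u`. -/
noncomputable def p1 (φ : ℝ → ℝ → ℝ) (u s : ℝ) : ℝ := deriv (fun t => φ t s) u

/-- First partial derivative of `φ = φ(u,s)` with respect to `s`. -/
noncomputable def p2 (φ : ℝ → ℝ → ℝ) (u s : ℝ) : ℝ := deriv (fun t => φ u t) s

/-- Second partial derivative `∂²φ/∂s²`. -/
noncomputable def p22 (φ : ℝ → ℝ → ℝ) (u s : ℝ) : ℝ := deriv (fun t => p2 φ u t) s

/-- Mixed partial derivative `∂²φ/∂u∂s`. -/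
noncomputable def p12 (φ : ℝ → ℝ → ℝ) (u s : ℝ) : ℝ := deriv (fun t => p2 φ t s) u

open scoped ContDiff

universe u

/-- Differentiation under the integral sign for a `C¹` integrand over a compact interval. -/
theorem hasFDerivAt_intervalIntegral_of_contDiff {E F : Type*} [NormedAddCommGroup E]
    [NormedSpace ℝ E] [ProperSpace E] [NormedAddCommGroup F] [NormedSpace ℝ F]
    {H : E × ℝ → F} (hH : ContDiff ℝ 1 H) (a b : ℝ) (x : E) :
    HasFDerivAt (fun y => ∫ t in a..b, H (y, t))
      (∫ t in a..b, (fderiv ℝ H (x, t)).comp (ContinuousLinearMap.inl ℝ E ℝ)) x := by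
  have hc : Continuous fun p : E × ℝ =>
      (fderiv ℝ H p).comp (ContinuousLinearMap.inl ℝ E ℝ) :=
    (hH.continuous_fderiv one_ne_zero).clm_comp continuous_const
  obtain ⟨C, hC⟩ := ((isCompact_closedBall x 1).prod
    (isCompact_uIcc (a := a) (b := b))).exists_bound_of_continuousOn hc.continuousOn
  refine intervalIntegral.hasFDerivAt_integral_of_dominated_of_fderiv_le
    (F' := fun y t => (fderiv ℝ H (y, t)).comp (ContinuousLinearMap.inl ℝ E ℝ))
    (bound := fun _ => C) (Metric.closedBall_mem_nhds x one_pos) ?_ ?_ ?_ ?_ ?_ ?_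
  · exact .of_forall fun y =>
      (hH.continuous.comp (Continuous.prodMk_right y)).aestronglyMeasurable
  · exact (hH.continuous.comp (Continuous.prodMk_right x)).intervalIntegrable a b
  · exact (hc.comp (Continuous.prodMk_right x)).aestronglyMeasurable
  · exact .of_forall fun t ht y hy => hC (y, t) ⟨hy, uIoc_subset_uIcc ht⟩
  · exact intervalIntegrable_const
  · exact .of_forall fun t _ y _ =>
      ((hH.differentiable one_ne_zero) (y, t)).hasFDerivAt.comp y (hasFDerivAt_prodMk_left y t)

theorem contDiff_intervalIntegral_of_contDiff_nat {E : Type u} [NormedAddCommGroup E]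
    [NormedSpace ℝ E] [ProperSpace E] (a b : ℝ) (n : ℕ) {F : Type u} [NormedAddCommGroup F]
    [NormedSpace ℝ F] {H : E × ℝ → F} (hH : ContDiff ℝ n H) :
    ContDiff ℝ n fun x => ∫ t in a..b, H (x, t) := by
  induction n generalizing F with
  | zero =>
    rw [Nat.cast_zero, contDiff_zero] at hH ⊢
    exact continuous_parametric_intervalIntegral_of_continuous' (f := fun x t => H (x, t)) hH a b
  | succ n ih =>
    rw [Nat.cast_succ] at hH ⊢
    exact contDiff_succ_iff_hasFDerivAt.2 ⟨_,
      ih (((contDiff_succ_iff_fderiv.1 hH).2.2).clm_comp contDiff_const),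
      hasFDerivAt_intervalIntegral_of_contDiff (hH.of_le (by simp)) a b⟩

/-- The integral over a compact interval of a smooth function is smooth in the parameter. -/
theorem contDiff_intervalIntegral_of_contDiff {E F : Type u} [NormedAddCommGroup E]
    [NormedSpace ℝ E] [ProperSpace E] [NormedAddCommGroup F] [NormedSpace ℝ F]
    {H : E × ℝ → F} (hH : ContDiff ℝ ∞ H) (a b : ℝ) :
    ContDiff ℝ ∞ fun x => ∫ t in a..b, H (x, t) :=
  contDiff_infty.2 fun n =>
    contDiff_intervalIntegral_of_contDiff_nat a b n (contDiff_infty.1 hH n)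

/-- The primitive of `z ↦ F (x - y z²)` vanishing at `0` depends smoothly on `x`, `y` and the
endpoint. -/
theorem contDiff_integral_comp_sub_mul_sq {F : ℝ → ℝ} (hF : ContDiff ℝ ∞ F) :
    ContDiff ℝ ∞ fun p : ℝ × ℝ × ℝ => ∫ z in (0 : ℝ)..p.2.2, F (p.1 - p.2.1 * z ^ 2) := by
  have h : ContDiff ℝ ∞ fun p : ℝ × ℝ × ℝ =>
      ∫ t in (0 : ℝ)..1, F (p.1 - p.2.1 * (p.2.2 * t) ^ 2) :=
    contDiff_intervalIntegral_of_contDiff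
      (H := fun q : (ℝ × ℝ × ℝ) × ℝ => F (q.1.1 - q.1.2.1 * (q.1.2.2 * q.2) ^ 2))
      (by fun_prop) 0 1
  have hs : ContDiff ℝ ∞ fun p : ℝ × ℝ × ℝ => p.2.2 := by fun_prop
  have he : (fun p : ℝ × ℝ × ℝ => ∫ z in (0 : ℝ)..p.2.2, F (p.1 - p.2.1 * z ^ 2)) =
      fun p => p.2.2 * ∫ t in (0 : ℝ)..1, F (p.1 - p.2.1 * (p.2.2 * t) ^ 2) := by
    ext p
    simpa using (mul_integral_comp_mul_left (a := 0) (b := 1)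
      (f := fun z => F (p.1 - p.2.1 * z ^ 2)) (c := p.2.2)).symm
  exact he ▸ hs.mul h

theorem stmt3
    (l : ℝ) (f g : ℝ → ℝ) (hf : ContDiff ℝ (⊤ : ℕ∞) f) (hg : ContDiff ℝ (⊤ : ℕ∞) g)
    (φ : ℝ → ℝ → ℝ)
    (hφ : ∀ u s, φ u s =
      f (u ^ l - u ^ (l - 1) * s ^ 2)
        + 2 * u ^ (l - 1) * s * (∫ z in (0:ℝ)..s, deriv f (u ^ l - u ^ (l - 1) * z ^ 2))
        + g u * s) :
    ContDiffOn ℝ (⊤ : ℕ∞) (Function.uncurry φ) (Set.Ioi 0 ×ˢ (Set.univ : Set ℝ)) ∧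
      ∀ u : ℝ, 0 < u → ∀ s : ℝ,
        (l * u - (l - 1) * s ^ 2) * p22 φ u s
          = 2 * u * (p1 φ u s - s * p12 φ u s) := by
  have hF : ContDiff ℝ ∞ (deriv f) := (contDiff_infty_iff_deriv.1 hf).2
  have hpow : ∀ r : ℝ, ContDiffOn ℝ ∞ (fun p : ℝ × ℝ => p.1 ^ r) (Ioi 0 ×ˢ univ) := fun r =>
    contDiff_fst.contDiffOn.rpow_const_of_ne fun p hp => (mem_Ioi.1 hp.1).ne'
  have hI : ContDiffOn ℝ ∞ (fun p : ℝ × ℝ =>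
      ∫ z in (0 : ℝ)..p.2, deriv f (p.1 ^ l - p.1 ^ (l - 1) * z ^ 2)) (Ioi 0 ×ˢ univ) :=
    (contDiff_integral_comp_sub_mul_sq hF).comp_contDiffOn
      ((hpow l).prodMk ((hpow (l - 1)).prodMk contDiff_snd.contDiffOn))
  have hs : ContDiffOn ℝ ∞ (fun p : ℝ × ℝ => p.2) (Ioi 0 ×ˢ univ) := contDiff_snd.contDiffOn
  refine ⟨?_, fun u hu s => ?_⟩
  · have hφ' : Function.uncurry φ = fun p : ℝ × ℝ => _ := funext fun p => hφ p.1 p.2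
    rw [hφ']
    exact ((hf.comp_contDiffOn ((hpow l).sub ((hpow (l - 1)).mul (hs.pow 2)))).add
      (((contDiffOn_const.mul (hpow (l - 1))).mul hs).mul hI)).add
      ((hg.comp contDiff_fst).contDiffOn.mul hs)
  · set J : ℝ → ℝ → ℝ := fun v t =>
      v ^ (l - 1) * ∫ z in (0 : ℝ)..t, deriv f (v ^ l - v ^ (l - 1) * z ^ 2) with hJ
    have hfd : ∀ x, HasDerivAt f (deriv f x) x := fun x =>
      (hf.differentiable (by simp) x).hasDerivAt
    have hgd : HasDerivAt g (deriv g u) u := (hg.differentiable (by simp) u).hasDerivAt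
    have hJs : ∀ v t, HasDerivAt (J v)
        (v ^ (l - 1) * deriv f (v ^ l - v ^ (l - 1) * t ^ 2)) t := fun v t =>
      (Continuous.integral_hasStrictDerivAt
        (hF.continuous.comp (by fun_prop : Continuous fun z : ℝ => v ^ l - v ^ (l - 1) * z ^ 2))
        0 t).hasDerivAt.const_mul _
    have hJu : HasDerivAt (fun v => J v s) (deriv (fun v => J v s) u) u := by
      have hd := (((hpow (l - 1)).mul hI).contDiffAt
        ((isOpen_Ioi.prod isOpen_univ).mem_nhds (show (u, s) ∈ _ from ⟨hu, mem_univ s⟩)))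
        |>.differentiableAt (by simp)
      exact (hd.comp u (f := fun v => (v, s)) (by fun_prop)).hasDerivAt
    have hφJ : ∀ v t, φ v t =
        f (v ^ l - v ^ (l - 1) * t ^ 2) + 2 * t * J v t + g v * t := fun v t => by
      rw [hφ, hJ]; ring
    have hp2 : ∀ v t, p2 φ v t = 2 * J v t + g v := fun v t => by
      have hq : HasDerivAt (fun t : ℝ => v ^ l - v ^ (l - 1) * t ^ 2)
          (-(v ^ (l - 1) * (2 * t))) t := by
        simpa using ((hasDerivAt_pow 2 t).const_mul (v ^ (l - 1))).const_sub (v ^ l)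
      have hd := (((hfd _).comp t hq).add
        (((hasDerivAt_id t).const_mul 2).mul (hJs v t))).add ((hasDerivAt_id t).const_mul (g v))
      rw [p2, show (fun t => φ v t) = _ from funext (hφJ v)]
      refine hd.deriv.trans ?_
      simp only [id]
      ring
    have hp22 : p22 φ u s = 2 * (u ^ (l - 1) * deriv f (u ^ l - u ^ (l - 1) * s ^ 2)) := by
      rw [p22, show (fun t => p2 φ u t) = _ from funext (hp2 u)]
      exact (((hJs u s).const_mul 2).add_const (g u)).deriv
    have hp12 : p12 φ u s = 2 * deriv (fun v => J v s) u + deriv g u := by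
      rw [p12, show (fun t => p2 φ t s) = _ from funext fun v => hp2 v s]
      exact ((hJu.const_mul 2).add hgd).deriv
    have hp1 : p1 φ u s = deriv f (u ^ l - u ^ (l - 1) * s ^ 2) *
        (l * u ^ (l - 1) - (l - 1) * u ^ (l - 1 - 1) * s ^ 2) +
        2 * s * deriv (fun v => J v s) u + deriv g u * s := by
      rw [p1, show (fun t => φ t s) = _ from funext fun v => hφJ v s]
      have hr : ∀ r : ℝ, HasDerivAt (fun v : ℝ => v ^ r) (r * u ^ (r - 1)) u := fun r =>
        Real.hasDerivAt_rpow_const (.inl hu.ne')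
      exact ((((hfd _).comp u ((hr l).sub ((hr (l - 1)).mul_const (s ^ 2)))).add
        (hJu.const_mul (2 * s))).add (hgd.mul_const s)).deriv
    rw [hp22, hp12, hp1, Real.rpow_sub_one hu.ne' (l - 1)]
    field_simp
    ring
end

section
/- Let b₀ > 0 and Ω = {(u,s) ∈ ℝ² : 0 < u < b₀ and s² < u}. A smooth function φ : Ω → ℝ satisfies φ₂₂(u,s) = 2·(φ₁(u,s) − s·φ₁₂(u,s)) on Ω if and only if there exist smooth functions f : (0, b₀) → ℝ and g : (0, b₀) → ℝ such that φ(u,s) = f(u − s²) + 2s·∫₀ˢ f'(u − z²) dz + g(u)·s for all (u,s) ∈ Ω. -/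
open Real Set MeasureTheory intervalIntegral

section PartialDerivatives

variable {φ : ℝ → ℝ → ℝ} {Ω : Set (ℝ × ℝ)} {u s : ℝ}

lemma hasFDerivAt_uncurry_p1_p2 (hφ : DifferentiableAt ℝ (Function.uncurry φ) (u, s)) :
    HasFDerivAt (Function.uncurry φ)
      (p1 φ u s • ContinuousLinearMap.fst ℝ ℝ ℝ + p2 φ u s • ContinuousLinearMap.snd ℝ ℝ ℝ)
      (u, s) := by
  have h := hφ.hasFDerivAt
  have h1 : p1 φ u s = fderiv ℝ (Function.uncurry φ) (u, s) (1, 0) :=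
    (h.comp_hasDerivAt (f := fun t => (t, s)) u ((hasDerivAt_id' u).prodMk (hasDerivAt_const u s))).deriv
  have h2 : p2 φ u s = fderiv ℝ (Function.uncurry φ) (u, s) (0, 1) :=
    (h.comp_hasDerivAt (f := fun t => (u, t)) s ((hasDerivAt_const s u).prodMk (hasDerivAt_id' s))).deriv
  convert h using 1
  ext <;> simp [h1, h2]

/-- The chain rule for `φ` along a plane curve. -/
lemma hasDerivAt_comp_curve {a b : ℝ → ℝ} {a' b' t : ℝ}
    (hφ : DifferentiableAt ℝ (Function.uncurry φ) (a t, b t))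
    (ha : HasDerivAt a a' t) (hb : HasDerivAt b b' t) :
    HasDerivAt (fun r => φ (a r) (b r)) (p1 φ (a t) (b t) * a' + p2 φ (a t) (b t) * b') t := by
  have h := (hasFDerivAt_uncurry_p1_p2 hφ).comp_hasDerivAt t (ha.prodMk hb)
  simpa [Function.comp_def] using h

lemma hasDerivAt_p1 (hφ : DifferentiableAt ℝ (Function.uncurry φ) (u, s)) :
    HasDerivAt (fun t => φ t s) (p1 φ u s) u := by
  simpa using hasDerivAt_comp_curve (a := fun t => t) (b := fun _ => s) (t := u) hφ
    (hasDerivAt_id' u) (hasDerivAt_const u s)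

lemma hasDerivAt_p2 (hφ : DifferentiableAt ℝ (Function.uncurry φ) (u, s)) :
    HasDerivAt (fun t => φ u t) (p2 φ u s) s := by
  simpa using hasDerivAt_comp_curve (a := fun _ => u) (b := fun t => t) (t := s) hφ
    (hasDerivAt_const s u) (hasDerivAt_id' s)

lemma contDiffOn_uncurry_p2 (hΩ : IsOpen Ω)
    (hφ : ContDiffOn ℝ (⊤ : ℕ∞) (Function.uncurry φ) Ω) :
    ContDiffOn ℝ (⊤ : ℕ∞) (Function.uncurry (p2 φ)) Ω := by
  have h : ContDiffOn ℝ (⊤ : ℕ∞) (fun p => fderiv ℝ (Function.uncurry φ) p (0, 1)) Ω :=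
    (hφ.fderiv_of_isOpen hΩ (by simp)).clm_apply contDiffOn_const
  refine h.congr ?_
  rintro ⟨u, s⟩ hp
  have hd := (hφ.contDiffAt (hΩ.mem_nhds hp)).differentiableAt (by simp)
  simp [(hasFDerivAt_uncurry_p1_p2 hd).fderiv]

end PartialDerivatives

lemma sq_le_sq_of_mem_uIcc_zero {t s : ℝ} (ht : t ∈ uIcc 0 s) : t ^ 2 ≤ s ^ 2 := by
  have h := abs_sub_left_of_mem_uIcc ht
  simp only [sub_zero] at h
  exact sq_le_sq.mpr h

lemma isOpen_parabolic_region (b : ℝ) :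
    IsOpen {p : ℝ × ℝ | 0 < p.1 ∧ p.1 < b ∧ p.2 ^ 2 < p.1} :=
  (isOpen_lt continuous_const continuous_fst).inter
    ((isOpen_lt continuous_fst continuous_const).inter
      (isOpen_lt (continuous_snd.pow 2) continuous_fst))

lemma sub_sq_mem_Ioo {b u s z : ℝ} (hu : u < b) (hs : s ^ 2 < u) (hz : z ∈ uIcc 0 s) :
    u - z ^ 2 ∈ Ioo 0 b := by
  have := sq_le_sq_of_mem_uIcc_zero hz
  constructor <;> nlinarith [sq_nonneg z]

lemma continuousOn_deriv_comp_sub_sq {b u s : ℝ} {f : ℝ → ℝ}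
    (hf : ContDiffOn ℝ (⊤ : ℕ∞) f (Ioo 0 b)) (hu : u < b) (hs : s ^ 2 < u) :
    ContinuousOn (fun z => deriv f (u - z ^ 2)) (uIcc 0 s) :=
  (hf.continuousOn_deriv_of_isOpen isOpen_Ioo (by simp)).comp (by fun_prop)
    fun _ hz => sub_sq_mem_Ioo hu hs hz

/-- Along the characteristics `u - s ^ 2 = const`, the function `φ - s * p2 φ` is constant. -/
lemma sub_mul_p2_eq_of_pde {b : ℝ} {φ : ℝ → ℝ → ℝ}
    (hφ : ∀ u s : ℝ, u < b → s ^ 2 < u → DifferentiableAt ℝ (Function.uncurry φ) (u, s))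
    (hφ' : ∀ u s : ℝ, u < b → s ^ 2 < u → DifferentiableAt ℝ (Function.uncurry (p2 φ)) (u, s))
    (hpde : ∀ u s : ℝ, u < b → s ^ 2 < u → p22 φ u s = 2 * (p1 φ u s - s * p12 φ u s))
    {u s : ℝ} (hu : u < b) (hs : s ^ 2 < u) :
    φ u s - s * p2 φ u s = φ (u - s ^ 2) 0 := by
  have key : ∀ t ∈ uIcc 0 s, HasDerivAt
      (fun r => φ (u - s ^ 2 + r ^ 2) r - r * p2 φ (u - s ^ 2 + r ^ 2) r) 0 t := by
    intro t ht
    have hts := sq_le_sq_of_mem_uIcc_zero ht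
    have h1 : u - s ^ 2 + t ^ 2 < b := by linarith
    have h2 : t ^ 2 < u - s ^ 2 + t ^ 2 := by linarith
    have hc : HasDerivAt (fun r : ℝ => u - s ^ 2 + r ^ 2) (2 * t) t := by
      simpa using (hasDerivAt_pow 2 t).const_add (u - s ^ 2)
    have d1 := hasDerivAt_comp_curve (a := fun r => u - s ^ 2 + r ^ 2) (b := fun r => r)
      (hφ _ _ h1 h2) hc (hasDerivAt_id' t)
    have d2 := hasDerivAt_comp_curve (a := fun r => u - s ^ 2 + r ^ 2) (b := fun r => r)
      (hφ' _ _ h1 h2) hc (hasDerivAt_id' t)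
    refine (d1.sub ((hasDerivAt_id' t).mul d2)).congr_deriv ?_
    have e := hpde _ _ h1 h2
    change p2 (p2 φ) _ _ = 2 * (_ - t * p1 (p2 φ) _ _) at e
    rw [e]
    ring
  have h := integral_eq_sub_of_hasDerivAt key intervalIntegrable_const
  simp only [intervalIntegral.integral_zero, sub_add_cancel, ne_eq, OfNat.ofNat_ne_zero,
    not_false_eq_true, zero_pow, add_zero, zero_mul, sub_zero] at h
  linarith

lemma eq_of_pde {b : ℝ} {φ : ℝ → ℝ → ℝ}
    (hφ : ∀ u s : ℝ, u < b → s ^ 2 < u → DifferentiableAt ℝ (Function.uncurry φ) (u, s))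
    (hφ' : ∀ u s : ℝ, u < b → s ^ 2 < u → DifferentiableAt ℝ (Function.uncurry (p2 φ)) (u, s))
    (hf : ContDiffOn ℝ (⊤ : ℕ∞) (fun t => φ t 0) (Ioo 0 b))
    (hpde : ∀ u s : ℝ, u < b → s ^ 2 < u → p22 φ u s = 2 * (p1 φ u s - s * p12 φ u s))
    {u s : ℝ} (hu : u < b) (hs : s ^ 2 < u) :
    φ u s = φ (u - s ^ 2) 0 + 2 * s * (∫ z in (0 : ℝ)..s, deriv (fun t => φ t 0) (u - z ^ 2))
      + p2 φ u 0 * s := by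
  have hp22 : ∀ z, z ^ 2 < u → p22 φ u z = 2 * deriv (fun t => φ t 0) (u - z ^ 2) := by
    intro z hz
    have hmem : u - z ^ 2 ∈ Ioo 0 b := ⟨by linarith, by nlinarith [sq_nonneg z]⟩
    have d1 := (hasDerivAt_p1 (hφ u z hu hz)).sub ((hasDerivAt_p1 (hφ' u z hu hz)).const_mul z)
    have d2 : HasDerivAt (fun t => φ (t - z ^ 2) 0) (deriv (fun t => φ t 0) (u - z ^ 2)) u := by
      have := (hf.contDiffAt (isOpen_Ioo.mem_nhds hmem)).differentiableAt (by simp)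
      exact this.hasDerivAt.comp_sub_const u (z ^ 2)
    have heq : (fun t => φ t z - z * p2 φ t z) =ᶠ[nhds u] fun t => φ (t - z ^ 2) 0 := by
      filter_upwards [isOpen_Ioo.mem_nhds (show u ∈ Ioo (z ^ 2) b from ⟨hz, hu⟩)] with t ht
      exact sub_mul_p2_eq_of_pde hφ hφ' hpde ht.2 ht.1
    rw [hpde u z hu hz, (d2.congr_of_eventuallyEq heq).unique d1]
    rfl
  have hp2 : p2 φ u s - p2 φ u 0 = 2 * ∫ z in (0 : ℝ)..s, deriv (fun t => φ t 0) (u - z ^ 2) := by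
    rw [← intervalIntegral.integral_const_mul, eq_comm]
    refine integral_eq_sub_of_hasDerivAt (fun z hz => ?_)
      ((continuousOn_deriv_comp_sub_sq hf hu hs).const_mul 2).intervalIntegrable
    have hz' : z ^ 2 < u := (sq_le_sq_of_mem_uIcc_zero hz).trans_lt hs
    rw [← hp22 z hz']
    exact hasDerivAt_p2 (hφ' u z hu hz')
  linear_combination sub_mul_p2_eq_of_pde hφ hφ' hpde hu hs + s * hp2

lemma pde_of_eq {b : ℝ} {φ : ℝ → ℝ → ℝ} {f g : ℝ → ℝ}
    (hφ : ∀ u s : ℝ, u < b → s ^ 2 < u → DifferentiableAt ℝ (Function.uncurry φ) (u, s))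
    (hφ' : ∀ u s : ℝ, u < b → s ^ 2 < u → DifferentiableAt ℝ (Function.uncurry (p2 φ)) (u, s))
    (hf : ContDiffOn ℝ (⊤ : ℕ∞) f (Ioo 0 b))
    (heq : ∀ u s : ℝ, u < b → s ^ 2 < u →
      φ u s = f (u - s ^ 2) + 2 * s * (∫ z in (0 : ℝ)..s, deriv f (u - z ^ 2)) + g u * s)
    {u s : ℝ} (hu : u < b) (hs : s ^ 2 < u) :
    p22 φ u s = 2 * (p1 φ u s - s * p12 φ u s) := by
  have hfd : ∀ u s : ℝ, u < b → s ^ 2 < u → HasDerivAt f (deriv f (u - s ^ 2)) (u - s ^ 2) :=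
    fun u s hu hs => ((hf.contDiffAt (isOpen_Ioo.mem_nhds
      (sub_sq_mem_Ioo hu hs right_mem_uIcc))).differentiableAt (by simp)).hasDerivAt
  have hopen : IsOpen {t : ℝ | t ^ 2 < u} := isOpen_lt (by fun_prop) continuous_const
  have hint : ∀ u s : ℝ, u < b → s ^ 2 < u →
      HasDerivAt (fun t => ∫ z in (0 : ℝ)..t, deriv f (u - z ^ 2)) (deriv f (u - s ^ 2)) s := by
    intro u s hu hs
    have hopen : IsOpen {t : ℝ | t ^ 2 < u} := isOpen_lt (by fun_prop) continuous_const
    have hcont : ContinuousOn (fun z => deriv f (u - z ^ 2)) {t : ℝ | t ^ 2 < u} :=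
      (hf.continuousOn_deriv_of_isOpen isOpen_Ioo (by simp)).comp (by fun_prop)
        fun _ hz => sub_sq_mem_Ioo hu hz right_mem_uIcc
    exact integral_hasDerivAt_right (continuousOn_deriv_comp_sub_sq hf hu hs).intervalIntegrable
      (hcont.stronglyMeasurableAtFilter hopen s hs) (hcont.continuousAt (hopen.mem_nhds hs))
  have hp2 : ∀ u s : ℝ, u < b → s ^ 2 < u →
      p2 φ u s = 2 * (∫ z in (0 : ℝ)..s, deriv f (u - z ^ 2)) + g u := by
    intro u s hu hs
    have hopen : IsOpen {t : ℝ | t ^ 2 < u} := isOpen_lt (by fun_prop) continuous_const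
    have hsq : HasDerivAt (fun r : ℝ => u - r ^ 2) (-(2 * s)) s := by
      simpa using (hasDerivAt_pow 2 s).const_sub u
    have d := (((hfd u s hu hs).comp s hsq).add
      (((hasDerivAt_id' s).const_mul 2).mul (hint u s hu hs))).add
      ((hasDerivAt_id' s).const_mul (g u))
    have hev : (fun t => φ u t) =ᶠ[nhds s] fun t => f (u - t ^ 2)
        + 2 * t * (∫ z in (0 : ℝ)..t, deriv f (u - z ^ 2)) + g u * t := by
      filter_upwards [hopen.mem_nhds hs] with t ht using heq u t hu ht
    refine (d.congr_of_eventuallyEq hev).deriv.trans ?_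
    ring
  have hp22 : p22 φ u s = 2 * deriv f (u - s ^ 2) := by
    have hev : (fun t => p2 φ u t) =ᶠ[nhds s] fun t =>
        2 * (∫ z in (0 : ℝ)..t, deriv f (u - z ^ 2)) + g u := by
      filter_upwards [hopen.mem_nhds hs] with t ht using hp2 u t hu ht
    exact ((((hint u s hu hs).const_mul 2).add_const (g u)).congr_of_eventuallyEq hev).deriv
  have d1 := (hasDerivAt_p1 (hφ u s hu hs)).sub ((hasDerivAt_p1 (hφ' u s hu hs)).const_mul s)
  have hev : (fun t => φ t s - s * p2 φ t s) =ᶠ[nhds u] fun t => f (t - s ^ 2) := by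
    filter_upwards [isOpen_Ioo.mem_nhds (show u ∈ Ioo (s ^ 2) b from ⟨hs, hu⟩)] with t ht
    rw [heq t s ht.2 ht.1, hp2 t s ht.2 ht.1]
    ring
  have d2 := ((hfd u s hu hs).comp_sub_const u (s ^ 2)).congr_of_eventuallyEq hev
  rw [hp22, d2.unique d1]
  rfl

theorem stmt5
    (b₀ : ℝ) (hb₀ : 0 < b₀)
    (Ω : Set (ℝ × ℝ))
    (hΩ : Ω = {p : ℝ × ℝ | 0 < p.1 ∧ p.1 < b₀ ∧ p.2 ^ 2 < p.1})
    (φ : ℝ → ℝ → ℝ)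
    (hφ : ContDiffOn ℝ (⊤ : ℕ∞) (Function.uncurry φ) Ω) :
    (∀ u s : ℝ, (u, s) ∈ Ω →
        p22 φ u s = 2 * (p1 φ u s - s * p12 φ u s)) ↔
      ∃ f g : ℝ → ℝ,
        ContDiffOn ℝ (⊤ : ℕ∞) f (Set.Ioo 0 b₀) ∧ ContDiffOn ℝ (⊤ : ℕ∞) g (Set.Ioo 0 b₀) ∧
          ∀ u s : ℝ, (u, s) ∈ Ω →
            φ u s =
              f (u - s ^ 2)
                + 2 * s * (∫ z in (0:ℝ)..s, deriv f (u - z ^ 2))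
                + g u * s := by
  have hopen : IsOpen Ω := hΩ ▸ isOpen_parabolic_region b₀
  have hmem : ∀ u s : ℝ, (u, s) ∈ Ω ↔ u < b₀ ∧ s ^ 2 < u := by
    intro u s
    rw [hΩ]
    exact ⟨fun h => h.2, fun h => ⟨(sq_nonneg s).trans_lt h.2, h⟩⟩
  have hφ₂ := contDiffOn_uncurry_p2 hopen hφ
  have hdiff : ∀ {ψ : ℝ → ℝ → ℝ}, ContDiffOn ℝ (⊤ : ℕ∞) (Function.uncurry ψ) Ω →
      ∀ u s : ℝ, u < b₀ → s ^ 2 < u → DifferentiableAt ℝ (Function.uncurry ψ) (u, s) :=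
    fun hψ u s hu hs => (hψ.contDiffAt
      (hopen.mem_nhds ((hmem u s).2 ⟨hu, hs⟩))).differentiableAt (by simp)
  have haxis : ∀ {ψ : ℝ → ℝ → ℝ}, ContDiffOn ℝ (⊤ : ℕ∞) (Function.uncurry ψ) Ω →
      ContDiffOn ℝ (⊤ : ℕ∞) (fun t => ψ t 0) (Ioo 0 b₀) :=
    fun hψ => hψ.comp (contDiffOn_id.prodMk contDiffOn_const)
      fun t ht => (hmem t 0).2 ⟨ht.2, by simpa using ht.1⟩
  constructor
  · intro hpde
    exact ⟨fun t => φ t 0, fun t => p2 φ t 0, haxis hφ, haxis hφ₂, fun u s h =>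
      eq_of_pde (hdiff hφ) (hdiff hφ₂) (haxis hφ)
        (fun u s hu hs => hpde u s ((hmem u s).2 ⟨hu, hs⟩))
        ((hmem u s).1 h).1 ((hmem u s).1 h).2⟩
  · rintro ⟨f, g, hf, -, heq⟩ u s h
    exact pde_of_eq (hdiff hφ) (hdiff hφ₂) hf
      (fun u s hu hs => heq u s ((hmem u s).2 ⟨hu, hs⟩))
      ((hmem u s).1 h).1 ((hmem u s).1 h).2
end
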